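/- Let κ ≠ 0 be a real number, let I, J ⊆ ℝ be open intervals with t + x > 0 for all t ∈ I, x ∈ J, and fix x₀ ∈ J. Let v : ℝ² → ℝ be C² on I × J and satisfy the transformed equation (EP') there. Then there exist a C¹ function S : I → ℝ and a continuous function R : J → ℝ such that v(t,x) = (t+x)^((1−2κ)/κ)·(S(t) + ∫_{x₀}^{x} R(s)·(t+s)^(1/κ) ds) for all (t,x) ∈ I × J. -/

import Mathlib

open Real Set

/-- Partial derivative with respect to the first variable. -/
noncomputable def pdt (f : ℝ × ℝ → ℝ) (p : ℝ × ℝ) : ℝ :=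
  deriv (fun s => f (s, p.2)) p.1

/-- Partial derivative with respect to the second variable. -/
noncomputable def pdx (f : ℝ × ℝ → ℝ) (p : ℝ × ℝ) : ℝ :=
  deriv (fun s => f (p.1, s)) p.2

/-- On an open set, the partial derivative in the second variable of a `C²` function is `C¹`. -/
lemma contDiffOn_pdx {U : Set (ℝ × ℝ)} (hU : IsOpen U) {v : ℝ × ℝ → ℝ}
    (hv : ContDiffOn ℝ 2 v U) : ContDiffOn ℝ 1 (pdx v) U := by
  have h : ContDiffOn ℝ 1 (fun p => fderiv ℝ v p (0, 1)) U :=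
    (hv.fderiv_of_isOpen hU (by norm_num)).clm_apply contDiffOn_const
  refine h.congr fun p hp => ?_
  have hd : HasFDerivAt v (fderiv ℝ v p) (p.1, p.2) :=
    ((hv.differentiableOn (by norm_num)).differentiableAt (hU.mem_nhds hp)).hasFDerivAt
  exact (hd.comp_hasDerivAt p.2 ((hasDerivAt_const p.2 p.1).prodMk (hasDerivAt_id p.2))).deriv

lemma hasDerivAt_pdt {f : ℝ × ℝ → ℝ} {t x : ℝ} (hf : DifferentiableAt ℝ f (t, x)) :
    HasDerivAt (fun s => f (s, x)) (pdt f (t, x)) t :=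
  DifferentiableAt.hasDerivAt (f := fun s => f (s, x))
    (hf.comp t (differentiableAt_id.prodMk (differentiableAt_const x)))

lemma hasDerivAt_pdx {f : ℝ × ℝ → ℝ} {t x : ℝ} (hf : DifferentiableAt ℝ f (t, x)) :
    HasDerivAt (fun s => f (t, s)) (pdx f (t, x)) x :=
  DifferentiableAt.hasDerivAt (f := fun s => f (t, s))
    (hf.comp x ((differentiableAt_const t).prodMk differentiableAt_id))

/-- Every solution of the transformed equation (EP') on a product of intervals has the
form v = (t+x)^((1-2κ)/κ)(S(t) + ∫ R(s)(t+s)^(1/κ) ds). -/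
theorem representation_of_solutions_of_transformed_equation
    (κ : ℝ) (hκ : κ ≠ 0)
    (I J : Set ℝ) (hIopen : IsOpen I) (hIconn : I.OrdConnected)
    (hJopen : IsOpen J) (hJconn : J.OrdConnected)
    (hpos : ∀ t ∈ I, ∀ x ∈ J, 0 < t + x)
    (x₀ : ℝ) (hx₀ : x₀ ∈ J)
    (v : ℝ × ℝ → ℝ) (hv : ContDiffOn ℝ 2 v (I ×ˢ J))
    (hEP' : ∀ p ∈ I ×ˢ J, pdt (pdx v) p =
      (1 - 2 * κ) * pdt v p / (κ * (p.1 + p.2))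
      + 2 * (1 - κ) * pdx v p / (κ * (p.1 + p.2))
      - (2 * κ - 1) * (κ - 2) * v p / (κ * (p.1 + p.2)) ^ 2) :
    ∃ S R : ℝ → ℝ, ContDiffOn ℝ 1 S I ∧ ContinuousOn R J ∧
      ∀ p ∈ I ×ˢ J, v p = (p.1 + p.2) ^ ((1 - 2 * κ) / κ) *
        (S p.1 + ∫ s in x₀..p.2, R s * (p.1 + s) ^ (1 / κ)) := by
  rcases I.eq_empty_or_nonempty with rfl | ⟨t₀, ht₀⟩
  · exact ⟨0, 0, by simp, continuousOn_const, by simp⟩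
  have hU : IsOpen (I ×ˢ J) := hIopen.prod hJopen
  have hvx := contDiffOn_pdx hU hv
  have dv : ∀ t ∈ I, ∀ x ∈ J, DifferentiableAt ℝ v (t, x) := fun t ht x hx =>
    (hv.differentiableOn (by norm_num)).differentiableAt (hU.mem_nhds ⟨ht, hx⟩)
  have dvx : ∀ t ∈ I, ∀ x ∈ J, DifferentiableAt ℝ (pdx v) (t, x) := fun t ht x hx =>
    (hvx.differentiableOn (by norm_num)).differentiableAt (hU.mem_nhds ⟨ht, hx⟩)
  obtain ⟨c, hc⟩ : ∃ c, c = 1 / κ := ⟨_, rfl⟩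
  have hac : (1 - 2 * κ) / κ = c - 2 := by rw [hc]; field_simp
  have hEP : ∀ t ∈ I, ∀ x ∈ J, pdt (pdx v) (t, x) = (c - 2) * pdt v (t, x) / (t + x)
      + (2 * c - 2) * pdx v (t, x) / (t + x)
      - (c - 2) * (2 * c - 1) * v (t, x) / (t + x) ^ 2 := by
    intro t ht x hx
    have := (hpos t ht x hx).ne'
    rw [hEP' (t, x) ⟨ht, hx⟩, hc]
    field_simp
    ring
  -- the first integral: `(t + x) ^ (-c)` times the `x`-derivative of `(t + x) ^ (2 - c) * v`
  let w : ℝ → ℝ → ℝ := fun t x =>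
    (pdx v (t, x) - (c - 2) * v (t, x) / (t + x)) * (t + x) ^ (2 - 2 * c)
  have hw : ∀ x ∈ J, ∀ t ∈ I, HasDerivAt (fun t => w t x) 0 t := by
    intro x hx t ht
    have hs := (hpos t ht x hx).ne'
    have h1 : HasDerivAt (fun t : ℝ => t + x) 1 t := (hasDerivAt_id t).add_const x
    have h := ((hasDerivAt_pdt (dvx t ht x hx)).sub
      (((hasDerivAt_pdt (dv t ht x hx)).const_mul (c - 2)).div h1 hs)).mul
      (h1.rpow_const (p := 2 - 2 * c) (Or.inl hs))
    refine h.congr_deriv ?_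
    simp only [Pi.sub_apply, Pi.div_apply]
    rw [hEP t ht x hx, rpow_sub_one hs]
    field_simp
    ring
  have hwconst : ∀ t ∈ I, ∀ x ∈ J, w t x = w t₀ x := fun t ht x hx =>
    hIopen.is_const_of_deriv_eq_zero hIconn.isPreconnected
      (fun t ht => (hw x hx t ht).differentiableAt.differentiableWithinAt)
      (fun t ht => (hw x hx t ht).deriv) ht ht₀
  have hRcont : ContinuousOn (w t₀) J := by
    have hm : MapsTo (fun x => (t₀, x)) J (I ×ˢ J) := fun x hx => ⟨ht₀, hx⟩
    have hp : ContinuousOn (fun x : ℝ => (t₀, x)) J := by fun_prop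
    have ha : ContinuousOn (fun x : ℝ => t₀ + x) J := by fun_prop
    have hne : ∀ x ∈ J, t₀ + x ≠ 0 := fun x hx => (hpos t₀ ht₀ x hx).ne'
    exact ((hvx.continuousOn.comp hp hm).sub
      ((continuousOn_const.mul (hv.continuousOn.comp hp hm)).div ha hne)).mul
      (ha.rpow_const fun x hx => Or.inl (hne x hx))
  refine ⟨fun t => (t + x₀) ^ (2 - c) * v (t, x₀), w t₀, ?_, hRcont, ?_⟩
  · refine ContDiffOn.mul ?_ ?_
    · exact (contDiffOn_id.add contDiffOn_const).rpow_const_of_ne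
        fun t ht => (hpos t ht x₀ hx₀).ne'
    · exact (hv.of_le (by norm_num)).comp (contDiffOn_id.prodMk contDiffOn_const)
        fun t ht => ⟨ht, hx₀⟩
  · rintro ⟨t, x⟩ ⟨ht, hx⟩
    simp only at ht hx
    have hsub : uIcc x₀ x ⊆ J := hJconn.uIcc_subset hx₀ hx
    have hderiv : ∀ s ∈ uIcc x₀ x,
        HasDerivAt (fun s => (t + s) ^ (2 - c) * v (t, s)) (w t₀ s * (t + s) ^ c) s := by
      intro s hs
      have hsJ := hsub hs
      have hp := hpos t ht s hsJ
      have h1 : HasDerivAt (fun s : ℝ => t + s) 1 s := (hasDerivAt_id s).const_add t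
      refine ((h1.rpow_const (p := 2 - c) (Or.inl hp.ne')).mul
        (hasDerivAt_pdx (dv t ht s hsJ))).congr_deriv ?_
      have hpow : (t + s) ^ (2 - c) = (t + s) ^ (2 - 2 * c) * (t + s) ^ c := by
        rw [← rpow_add hp]; ring_nf
      rw [← hwconst t ht s hsJ, rpow_sub_one hp.ne', hpow]
      simp only [w]
      have := hp.ne'
      field_simp
      ring
    have hint : IntervalIntegrable (fun s => w t₀ s * (t + s) ^ c) MeasureTheory.volume x₀ x :=
      ((hRcont.mono hsub).mul ((continuousOn_const.add continuousOn_id).rpow_const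
        fun s hs => Or.inl (hpos t ht s (hsub hs)).ne')).intervalIntegrable
    have hcancel : (t + x) ^ (c - 2) * (t + x) ^ (2 - c) = 1 := by
      rw [← rpow_add (hpos t ht x hx)]; simp
    simp only [hac, ← hc]
    rw [intervalIntegral.integral_eq_sub_of_hasDerivAt hderiv hint, add_sub_cancel,
      ← mul_assoc, hcancel, one_mul]
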